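/- In the Hopf algebra H associated to a closed Hecke symmetry R (generated by z^i_j, t^i_j with relations z^i_m z^j_n R^{mn}_{kl} = R^{ij}_{pq} z^p_k z^q_l and z^i_k t^k_j = t^i_k z^k_j = δ^i_j), the matrices Z = (z^i_j) and T = (t^i_j) satisfy: T is a two-sided inverse of Z, and the assignments S(z^i_j) = t^i_j, S(t^i_j) = C^i_k z^k_l (C⁻¹)^l_j define an antipode making H a Hopf algebra, where C^i_j := P^{im}_{jm} and P is the matrix with P^{im}_{jn} R^{nk}_{ml} = δ^i_l δ^k_j. -/

import Mathlib

open scoped TensorProduct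

/-- The defining relations of the Hopf algebra `H` of a closed Hecke symmetry:
the RTT relations among the `z^i_j` (encoded by `Sum.inl`) and the relations making
`T = (t^i_j)` (encoded by `Sum.inr`) a two-sided inverse of `Z = (z^i_j)`. -/
inductive HopfRel (k : Type*) [CommRing k] {d : ℕ}
    (R : Matrix (Fin d × Fin d) (Fin d × Fin d) k) :
    FreeAlgebra k ((Fin d × Fin d) ⊕ (Fin d × Fin d)) →
      FreeAlgebra k ((Fin d × Fin d) ⊕ (Fin d × Fin d)) → Prop
  | rtt (i j a b : Fin d) :
      HopfRel k R
        (∑ m : Fin d, ∑ n : Fin d, R (m, n) (a, b) •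
          (FreeAlgebra.ι k (Sum.inl (i, m)) * FreeAlgebra.ι k (Sum.inl (j, n))))
        (∑ p : Fin d, ∑ s : Fin d, R (i, j) (p, s) •
          (FreeAlgebra.ι k (Sum.inl (p, a)) * FreeAlgebra.ι k (Sum.inl (s, b))))
  | zt (i j : Fin d) :
      HopfRel k R
        (∑ m : Fin d, FreeAlgebra.ι k (Sum.inl (i, m)) * FreeAlgebra.ι k (Sum.inr (m, j)))
        (algebraMap k _ (if i = j then 1 else 0))
  | tz (i j : Fin d) :
      HopfRel k R
        (∑ m : Fin d, FreeAlgebra.ι k (Sum.inr (i, m)) * FreeAlgebra.ι k (Sum.inl (m, j)))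
        (algebraMap k _ (if i = j then 1 else 0))

/-- The Hopf algebra `H` associated to a closed Hecke symmetry, as an algebra. -/
def MatrixQG (k : Type*) [CommRing k] {d : ℕ}
    (R : Matrix (Fin d × Fin d) (Fin d × Fin d) k) : Type _ :=
  RingQuot (HopfRel k R)

noncomputable instance (k : Type*) [CommRing k] {d : ℕ}
    (R : Matrix (Fin d × Fin d) (Fin d × Fin d) k) : Ring (MatrixQG k R) :=
  inferInstanceAs (Ring (RingQuot (HopfRel k R)))

noncomputable instance (k : Type*) [CommRing k] {d : ℕ}
    (R : Matrix (Fin d × Fin d) (Fin d × Fin d) k) : Algebra k (MatrixQG k R) :=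
  inferInstanceAs (Algebra k (RingQuot (HopfRel k R)))

/-- The generator `z^i_j` of `H`. -/
noncomputable def zG (k : Type*) [CommRing k] {d : ℕ}
    (R : Matrix (Fin d × Fin d) (Fin d × Fin d) k) (p : Fin d × Fin d) : MatrixQG k R :=
  RingQuot.mkAlgHom k (HopfRel k R) (FreeAlgebra.ι k (Sum.inl p))

/-- The generator `t^i_j` of `H`. -/
noncomputable def tG (k : Type*) [CommRing k] {d : ℕ}
    (R : Matrix (Fin d × Fin d) (Fin d × Fin d) k) (p : Fin d × Fin d) : MatrixQG k R :=
  RingQuot.mkAlgHom k (HopfRel k R) (FreeAlgebra.ι k (Sum.inr p))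


namespace MQG
open Matrix

section core
variable {k : Type*} [Field k] {d : ℕ} {A : Type*} [Ring A] [Algebra k A]

/-- scalar matrices inside `A`-matrices -/
noncomputable abbrev sc (A : Type*) [Ring A] [Algebra k A] {n : Type*} (f : Matrix n n k) : Matrix n n A :=
  f.map (algebraMap k A)

lemma sc_mul {n : Type*} [Fintype n] (f g : Matrix n n k) : sc A (f * g) = sc A f * sc A g := by
  simp [sc, Matrix.map_mul]

lemma sc_one {n : Type*} [DecidableEq n] : sc A (1 : Matrix n n k) = 1 := by
  simp [sc]

lemma sc_transpose_mul {n : Type*} [Fintype n] (f : Matrix n n k) (M : Matrix n n A) :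
    (sc A f * M)ᵀ = Mᵀ * sc A fᵀ := by
  ext i j
  simp only [Matrix.transpose_apply, Matrix.mul_apply, sc, Matrix.map_apply]
  exact Finset.sum_congr rfl fun x _ => Algebra.commutes _ _

lemma mul_sc_transpose {n : Type*} [Fintype n] (f : Matrix n n k) (M : Matrix n n A) :
    (M * sc A f)ᵀ = sc A fᵀ * Mᵀ := by
  ext i j
  simp only [Matrix.transpose_apply, Matrix.mul_apply, sc, Matrix.map_apply]
  exact Finset.sum_congr rfl fun x _ => (Algebra.commutes _ _).symm

/-- matrix acting on the first leg -/
def leg1 (z : Matrix (Fin d) (Fin d) A) : Matrix (Fin d × Fin d) (Fin d × Fin d) A :=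
  Matrix.of fun x y => if x.2 = y.2 then z x.1 y.1 else 0
/-- matrix acting on the second leg -/
def leg2 (z : Matrix (Fin d) (Fin d) A) : Matrix (Fin d × Fin d) (Fin d × Fin d) A :=
  Matrix.of fun x y => if x.1 = y.1 then z x.2 y.2 else 0

lemma leg1_mul (z t : Matrix (Fin d) (Fin d) A) : leg1 z * leg1 t = leg1 (z * t) := by
  ext ⟨i, j⟩ ⟨a, b⟩
  simp [leg1, Matrix.mul_apply, Fintype.sum_prod_type]

lemma leg2_mul (z t : Matrix (Fin d) (Fin d) A) : leg2 z * leg2 t = leg2 (z * t) := by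
  ext ⟨i, j⟩ ⟨a, b⟩
  simp [leg2, Matrix.mul_apply, Fintype.sum_prod_type]

lemma leg1_one : leg1 (1 : Matrix (Fin d) (Fin d) A) = 1 := by
  ext ⟨i, j⟩ ⟨a, b⟩
  simp only [leg1, Matrix.of_apply, Matrix.one_apply, Prod.mk.injEq]
  split_ifs <;> simp_all

lemma leg2_one : leg2 (1 : Matrix (Fin d) (Fin d) A) = 1 := by
  ext ⟨i, j⟩ ⟨a, b⟩
  simp only [leg2, Matrix.of_apply, Matrix.one_apply, Prod.mk.injEq]
  split_ifs <;> simp_all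

variable (R P : Matrix (Fin d × Fin d) (Fin d × Fin d) k) (z t : Matrix (Fin d) (Fin d) A)

/-- half dual of `R` -/
def Rs : Matrix (Fin d × Fin d) (Fin d × Fin d) k := Matrix.of fun x y => R (x.2, y.1) (x.1, y.2)
/-- the inverse of the half dual -/
def Ps : Matrix (Fin d × Fin d) (Fin d × Fin d) k := Matrix.of fun x y => P (x.2, y.1) (x.1, y.2)
/-- coefficients of `V ⊗ V*` -/
def Um : Matrix (Fin d × Fin d) (Fin d × Fin d) A := Matrix.of fun x y => z y.1 x.1 * t x.2 y.2
/-- coefficients of `V* ⊗ V` -/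
def Wm : Matrix (Fin d × Fin d) (Fin d × Fin d) A := Matrix.of fun x y => t x.2 y.2 * z y.1 x.1

lemma PsRs (hP : ∀ i j a b : Fin d,
      ∑ m : Fin d, ∑ n : Fin d, P (i, m) (j, n) * R (n, a) (m, b) =
        (if i = b then 1 else 0) * (if a = j then 1 else 0)) : Ps P * Rs R = 1 := by
  ext ⟨j, i⟩ ⟨a, b⟩
  have := hP i j a b
  simp only [Matrix.mul_apply, Ps, Rs, Matrix.of_apply, Fintype.sum_prod_type, this,
    Matrix.one_apply, Prod.mk.injEq]
  by_cases h1 : i = b <;> by_cases h2 : a = j <;> simp [h1, h2]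
  intro h; exact absurd h.symm h2

lemma mid (hzt : z * t = 1) (htz : t * z = 1)
    (hR : ∀ i j a b : Fin d, ∑ m, ∑ n, R (m, n) (a, b) • (z i m * z j n) =
      ∑ p, ∑ s, R (i, j) (p, s) • (z p a * z s b)) :
    sc A (Rs R) * Um z t = Wm z t * sc A (Rs R) := by
  have h1 : leg1 z * leg2 z * sc A R = sc A R * (leg1 z * leg2 z) := by
    ext ⟨i, j⟩ ⟨a, b⟩
    have := hR i j a b
    simp only [Algebra.smul_def] at this
    have h : ∀ x y : Fin d × Fin d, (leg1 z * leg2 z) x y = z x.1 y.1 * z x.2 y.2 := by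
      intro x y
      simp [leg1, leg2, Matrix.mul_apply, Fintype.sum_prod_type]
    rw [Matrix.mul_apply, Matrix.mul_apply]
    simp only [h, sc, Matrix.map_apply, Fintype.sum_prod_type]
    rw [← this]
    exact Finset.sum_congr rfl fun x _ => Finset.sum_congr rfl fun y _ => (Algebra.commutes _ _).symm
  have h2 : leg2 z * sc A R * leg2 t = leg1 t * sc A R * leg1 z := by
    have e1 : leg1 t * leg1 z = 1 := by rw [leg1_mul, htz, leg1_one]
    have e2 : leg2 z * leg2 t = 1 := by rw [leg2_mul, hzt, leg2_one]
    calc leg2 z * sc A R * leg2 t = (leg1 t * leg1 z) * leg2 z * sc A R * leg2 t := by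
          rw [e1, one_mul]
      _ = leg1 t * (leg1 z * leg2 z * sc A R) * leg2 t := by simp only [mul_assoc]
      _ = leg1 t * sc A R * leg1 z * (leg2 z * leg2 t) := by rw [h1]; simp only [mul_assoc]
      _ = _ := by rw [e2, mul_one]
  ext ⟨a, i⟩ ⟨j, b⟩
  have := congrFun (congrFun h2 (i, j)) (a, b)
  simp only [leg1, leg2, Matrix.mul_apply, Fintype.sum_prod_type, Matrix.of_apply, sc,
    Matrix.map_apply, ite_mul, mul_ite, zero_mul, mul_zero, Finset.sum_ite_eq, Finset.sum_ite_eq',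
    Finset.mem_univ, if_true, Finset.sum_ite_irrel, Finset.sum_const_zero, Finset.sum_mul] at this
  simp only [Matrix.mul_apply, Fintype.sum_prod_type, Matrix.of_apply, sc, Um, Wm, Rs,
    Matrix.map_apply]
  rw [Finset.sum_comm] at this
  calc _ = _ := Finset.sum_congr rfl fun x _ => Finset.sum_congr rfl fun y _ => by
          rw [← mul_assoc, Algebra.commutes]
    _ = _ := this
    _ = _ := Finset.sum_congr rfl fun x _ => Finset.sum_congr rfl fun y _ => by
          rw [mul_assoc, mul_assoc, Algebra.commutes]

/-- The matrix `C`. -/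
def Cm : Matrix (Fin d) (Fin d) k := Matrix.of fun i j : Fin d => ∑ m : Fin d, P (i, m) (j, m)

/-- The matrix `D_f`. -/
def Dm : Matrix (Fin d) (Fin d) k →ₗ[k] Matrix (Fin d) (Fin d) k where
  toFun f := Matrix.of fun a i => Matrix.vecMul (fun x : Fin d × Fin d => f x.1 x.2) (Ps P) (a, i)
  map_add' f g := by
    ext a i
    simp [Matrix.vecMul, dotProduct, add_mul, Finset.sum_add_distrib]
  map_smul' c f := by
    ext a i
    simp [Matrix.vecMul, dotProduct, mul_assoc, Finset.mul_sum]

lemma key (hPR : Ps P * Rs R = 1) (hm : sc A (Rs R) * Um z t = Wm z t * sc A (Rs R)) :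
    Um z t * sc A (Ps P) = sc A (Ps P) * Wm z t := by
  have e1 : sc A (Ps P) * sc A (Rs R) = 1 := by rw [← sc_mul, hPR, sc_one]
  have e2 : sc A (Rs R) * sc A (Ps P) = 1 := by rw [← sc_mul, mul_eq_one_comm.mp hPR, sc_one]
  calc Um z t * sc A (Ps P) = sc A (Ps P) * (sc A (Rs R) * Um z t) * sc A (Ps P) := by
        rw [← mul_assoc, e1, one_mul]
    _ = sc A (Ps P) * Wm z t * (sc A (Rs R) * sc A (Ps P)) := by rw [hm]; simp only [mul_assoc]
    _ = _ := by rw [e2, mul_one]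

lemma relC (htz : t * z = 1) (hk : Um z t * sc A (Ps P) = sc A (Ps P) * Wm z t) :
    zᵀ * sc A (Cm P)ᵀ * tᵀ = sc A (Cm P)ᵀ := by
  let δ : Fin d × Fin d → A := fun x => if x.1 = x.2 then 1 else 0
  have hW : Wm z t *ᵥ δ = δ := by
    ext ⟨a, i⟩
    have := congrFun (congrFun htz i) a
    rw [Matrix.mul_apply, Matrix.one_apply] at this
    simp only [Matrix.mulVec, dotProduct, Wm, δ, Matrix.of_apply, Fintype.sum_prod_type, mul_ite,
      mul_one, mul_zero, Finset.sum_ite_eq, Finset.mem_univ, if_true, this, eq_comm]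
  have hPd : sc A (Ps P) *ᵥ δ = fun x => algebraMap k A (Cm P x.2 x.1) := by
    ext ⟨a, i⟩
    simp only [Matrix.mulVec, dotProduct, Ps, δ, sc, Matrix.map_apply, Cm, Matrix.of_apply,
      Fintype.sum_prod_type, mul_ite,
      mul_one, mul_zero, Finset.sum_ite_eq, Finset.mem_univ, if_true, map_sum]
  have h := congrArg (fun M => M *ᵥ δ) hk
  simp only [← Matrix.mulVec_mulVec, hW, hPd] at h
  ext n l
  have h' := congrFun h (n, l)
  simp only [Matrix.mulVec, dotProduct, Um, Matrix.of_apply, Fintype.sum_prod_type] at h'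
  simp only [Matrix.mul_apply, Matrix.transpose_apply, sc, Matrix.map_apply, Finset.sum_mul]
  rw [Finset.sum_comm, ← h']
  exact Finset.sum_congr rfl fun x _ => Finset.sum_congr rfl fun y _ => by
          rw [mul_assoc, mul_assoc, Algebra.commutes]

lemma relD (f : Matrix (Fin d) (Fin d) k) (hf : z * sc A f * t = sc A f)
    (hk : Um z t * sc A (Ps P) = sc A (Ps P) * Wm z t) :
    tᵀ * sc A (Dm P f)ᵀ * zᵀ = sc A (Dm P f)ᵀ := by
  let φ : Fin d × Fin d → A := fun x => algebraMap k A (f x.1 x.2)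
  have hU : φ ᵥ* Um z t = φ := by
    ext ⟨j, b⟩
    have := congrFun (congrFun hf j) b
    simp only [Matrix.mul_apply, sc, Matrix.map_apply, Finset.sum_mul] at this
    rw [Finset.sum_comm] at this
    simp only [Matrix.vecMul, dotProduct, Um, φ, Matrix.of_apply, Fintype.sum_prod_type]
    rw [← this]
    exact Finset.sum_congr rfl fun x _ => Finset.sum_congr rfl fun y _ => by
          rw [← mul_assoc, Algebra.commutes]
  have hPd : φ ᵥ* sc A (Ps P) = fun x => algebraMap k A (Dm P f x.1 x.2) := by
    ext ⟨a, i⟩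
    simp [Matrix.vecMul, dotProduct, sc, φ, Dm]
  have h := congrArg (fun M => φ ᵥ* M) hk
  simp only [← Matrix.vecMul_vecMul, hU, hPd] at h
  ext p q
  have h' := congrFun h (q, p)
  simp only [Matrix.vecMul, dotProduct, Wm, Matrix.of_apply, Fintype.sum_prod_type] at h'
  simp only [Matrix.mul_apply, Matrix.transpose_apply, sc, Matrix.map_apply, Finset.sum_mul]
  rw [h']
  exact Finset.sum_congr rfl fun x _ => Finset.sum_congr rfl fun y _ => by
          rw [← mul_assoc, Algebra.commutes]

/-- the endomorphisms of the corepresentation `z` -/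
def EndZ : Submodule k (Matrix (Fin d) (Fin d) k) where
  carrier := {f | z * sc A f * t = sc A f}
  add_mem' {f g} hf hg := by
    have : sc A (f + g) = sc A f + sc A g := by ext; simp [sc]
    simp only [Set.mem_ofPred_eq] at *
    rw [this, mul_add, add_mul, hf, hg]
  zero_mem' := by
    have : sc A (0 : Matrix (Fin d) (Fin d) k) = 0 := by ext; simp [sc]
    simp only [Set.mem_ofPred_eq, this]; simp
  smul_mem' c f hf := by
    have : sc A (c • f) = c • sc A f := by
      ext i j
      simp only [sc, Matrix.map_apply, Matrix.smul_apply, smul_eq_mul, map_mul]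
      rw [Algebra.smul_def]
    simp only [Set.mem_ofPred_eq] at *
    rw [this, Matrix.mul_smul, Matrix.smul_mul, hf]

lemma closed (hzt : z * t = 1)
    (hk : Um z t * sc A (Ps P) = sc A (Ps P) * Wm z t)
    (hC : zᵀ * sc A (Cm P)ᵀ * tᵀ = sc A (Cm P)ᵀ)
    (f : Matrix (Fin d) (Fin d) k) (hf : f ∈ EndZ z t) : Cm P * Dm P f ∈ EndZ z t := by
  have hD := relD P z t f hf hk
  have h1 : tᵀ * sc A (Cm P * Dm P f)ᵀ = sc A (Cm P * Dm P f)ᵀ * tᵀ := by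
    rw [Matrix.transpose_mul, sc_mul]
    calc tᵀ * (sc A (Dm P f)ᵀ * sc A (Cm P)ᵀ) =
          tᵀ * (sc A (Dm P f)ᵀ * (zᵀ * sc A (Cm P)ᵀ * tᵀ)) := by rw [hC]
      _ = (tᵀ * sc A (Dm P f)ᵀ * zᵀ) * sc A (Cm P)ᵀ * tᵀ := by simp only [mul_assoc]
      _ = _ := by rw [hD]
  rw [← sc_transpose_mul, ← mul_sc_transpose] at h1
  have h2 := Matrix.transpose_injective h1
  change z * sc A (Cm P * Dm P f) * t = sc A (Cm P * Dm P f)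
  rw [mul_assoc, h2, ← mul_assoc, hzt, one_mul]

lemma relC' (hzt : z * t = 1) (htz : t * z = 1)
    (hPR : Ps P * Rs R = 1)
    (hk : Um z t * sc A (Ps P) = sc A (Ps P) * Wm z t)
    (C' : Matrix (Fin d) (Fin d) k) (hC : C' * Cm P = 1) :
    tᵀ * sc A C'ᵀ * zᵀ = sc A C'ᵀ := by
  have hCr := relC P z t htz hk
  let L : EndZ (k := k) z t →ₗ[k] EndZ (k := k) z t :=
    { toFun := fun f => ⟨Cm P * Dm P f.1, closed P z t hzt hk hCr f.1 f.2⟩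
      map_add' := fun f g => by ext1; simp [mul_add]
      map_smul' := fun c f => by ext1; simp }
  have hL : Function.Injective L := by
    rw [injective_iff_map_eq_zero]
    intro f hf
    have h1 : Cm P * Dm P f.1 = 0 := congrArg Subtype.val hf
    have h2 : Dm P f.1 = 0 := by
      rw [← one_mul (Dm P f.1), ← hC, mul_assoc, h1, mul_zero]
    have h3 : (fun x : Fin d × Fin d => f.1 x.1 x.2) ᵥ* Ps P = 0 := by
      ext ⟨a, i⟩
      exact congrFun (congrFun h2 a) i
    have h4 : (fun x : Fin d × Fin d => f.1 x.1 x.2) = 0 := by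
      rw [← Matrix.vecMul_one (fun x : Fin d × Fin d => f.1 x.1 x.2), ← hPR,
        ← Matrix.vecMul_vecMul, h3, Matrix.zero_vecMul]
    ext a i
    exact congrFun h4 (a, i)
  have hone : (1 : Matrix (Fin d) (Fin d) k) ∈ EndZ z t := by
    change z * sc A 1 * t = sc A 1
    rw [sc_one, mul_one, hzt]
  obtain ⟨f, hf⟩ := (LinearMap.injective_iff_surjective.mp hL) ⟨1, hone⟩
  have h1 : Cm P * Dm P f.1 = 1 := congrArg Subtype.val hf
  have h2 : Dm P f.1 = C' := by
    rw [← one_mul (Dm P f.1), ← hC, mul_assoc, h1, mul_one]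
  rw [← h2]
  exact relD P z t f.1 f.2 hk

end core

section alg
open scoped MulOpposite
variable {k : Type*} [Field k] {d : ℕ} (R : Matrix (Fin d × Fin d) (Fin d × Fin d) k)

lemma z_def (p : Fin d × Fin d) :
    RingQuot.mkAlgHom k (HopfRel k R) (FreeAlgebra.ι k (Sum.inl p)) = zG k R p := rfl
lemma t_def (p : Fin d × Fin d) :
    RingQuot.mkAlgHom k (HopfRel k R) (FreeAlgebra.ι k (Sum.inr p)) = tG k R p := rfl

/-- the quotient map -/
noncomputable def mk : FreeAlgebra k ((Fin d × Fin d) ⊕ (Fin d × Fin d)) →ₐ[k] MatrixQG k R :=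
  RingQuot.mkAlgHom k (HopfRel k R)

lemma mk_z (p : Fin d × Fin d) : mk R (FreeAlgebra.ι k (Sum.inl p)) = zG k R p := rfl
lemma mk_t (p : Fin d × Fin d) : mk R (FreeAlgebra.ι k (Sum.inr p)) = tG k R p := rfl

lemma mk_rel {x y} (h : HopfRel k R x y) : mk R x = mk R y := RingQuot.mkAlgHom_rel k h

lemma rtt (i j a b : Fin d) : ∑ m, ∑ n, R (m, n) (a, b) • (zG k R (i, m) * zG k R (j, n)) =
      ∑ p, ∑ s, R (i, j) (p, s) • (zG k R (p, a) * zG k R (s, b)) := by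
  have := mk_rel R (HopfRel.rtt (k := k) (R := R) i j a b)
  simpa only [map_sum, map_smul, map_mul, mk_z] using this

lemma zt (i j : Fin d) : ∑ m : Fin d, zG k R (i, m) * tG k R (m, j) =
      algebraMap k (MatrixQG k R) (if i = j then 1 else 0) := by
  have := mk_rel R (HopfRel.zt (k := k) (R := R) i j)
  simpa only [map_sum, map_mul, mk_z, mk_t, AlgHom.commutes] using this

lemma tz (i j : Fin d) : ∑ m : Fin d, tG k R (i, m) * zG k R (m, j) =
      algebraMap k (MatrixQG k R) (if i = j then 1 else 0) := by
  have := mk_rel R (HopfRel.tz (k := k) (R := R) i j)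
  simpa only [map_sum, map_mul, mk_z, mk_t, AlgHom.commutes] using this

variable {R}

lemma exists_lift {B : Type*} [Ring B] [Algebra k B] (z t : Fin d → Fin d → B)
    (h1 : ∀ i j a b, ∑ m, ∑ n, R (m, n) (a, b) • (z i m * z j n) =
      ∑ p, ∑ s, R (i, j) (p, s) • (z p a * z s b))
    (h2 : ∀ i j, ∑ m, z i m * t m j = algebraMap k B (if i = j then 1 else 0))
    (h3 : ∀ i j, ∑ m, t i m * z m j = algebraMap k B (if i = j then 1 else 0)) :
    ∃ F : MatrixQG k R →ₐ[k] B, (∀ i j, F (zG k R (i, j)) = z i j) ∧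
      (∀ i j, F (tG k R (i, j)) = t i j) := by
  let f : FreeAlgebra k ((Fin d × Fin d) ⊕ (Fin d × Fin d)) →ₐ[k] B :=
    FreeAlgebra.lift k (Sum.elim (fun p => z p.1 p.2) (fun p => t p.1 p.2))
  have fz : ∀ i j, f (FreeAlgebra.ι k (Sum.inl (i, j))) = z i j := fun i j => by simp [f]
  have ft : ∀ i j, f (FreeAlgebra.ι k (Sum.inr (i, j))) = t i j := fun i j => by simp [f]
  have hf : ∀ ⦃x y⦄, HopfRel k R x y → f x = f y := by
    intro x y h
    cases h with
    | rtt i j a b => simpa only [map_sum, map_smul, map_mul, fz] using h1 i j a b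
    | zt i j => simpa only [map_sum, map_mul, fz, ft, AlgHom.commutes] using h2 i j
    | tz i j => simpa only [map_sum, map_mul, fz, ft, AlgHom.commutes] using h3 i j
  let F : MatrixQG k R →ₐ[k] B := RingQuot.liftAlgHom k ⟨f, hf⟩
  have hF : ∀ x, F (mk R x) = f x := fun x => RingQuot.liftAlgHom_mkAlgHom_apply k f hf x
  exact ⟨F, fun i j => by rw [← mk_z, hF, fz], fun i j => by rw [← mk_t, hF, ft]⟩

lemma qind {p : MatrixQG k R → Prop} (hz : ∀ i j, p (zG k R (i, j))) (ht : ∀ i j, p (tG k R (i, j)))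
    (hs : ∀ r : k, p (algebraMap k _ r)) (ha : ∀ x y, p x → p y → p (x + y))
    (hm : ∀ x y, p x → p y → p (x * y)) (x : MatrixQG k R) : p x := by
  obtain ⟨y, rfl⟩ : ∃ y, mk R y = x := RingQuot.mkAlgHom_surjective k _ x
  induction y using FreeAlgebra.induction with
  | grade0 r => rw [AlgHom.commutes]; exact hs r
  | grade1 x =>
    rcases x with ⟨i, j⟩ | ⟨i, j⟩
    · exact hz i j
    · exact ht i j
  | mul a b ha hb => rw [map_mul]; exact hm _ _ ha hb
  | add a b h1 h2 => rw [map_add]; exact ha _ _ h1 h2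

lemma qext {B : Type*} [Ring B] [Algebra k B] {F G : MatrixQG k R →ₐ[k] B}
    (hz : ∀ i j, F (zG k R (i, j)) = G (zG k R (i, j)))
    (ht : ∀ i j, F (tG k R (i, j)) = G (tG k R (i, j))) : F = G := by
  ext x
  exact qind (p := fun x => F x = G x) hz ht (fun r => by simp)
    (fun x y hx hy => by simp [hx, hy]) (fun x y hx hy => by simp [hx, hy]) x

variable (R)

lemma exists_comul : ∃ F : MatrixQG k R →ₐ[k] MatrixQG k R ⊗[k] MatrixQG k R,
    (∀ i j, F (zG k R (i, j)) = ∑ m, zG k R (i, m) ⊗ₜ[k] zG k R (m, j)) ∧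
    (∀ i j, F (tG k R (i, j)) = ∑ m, tG k R (m, j) ⊗ₜ[k] tG k R (i, m)) := by
  apply exists_lift
  · intro i j a b
    have h1 : ∀ m n, (∑ x, zG k R (i, x) ⊗ₜ[k] zG k R (x, m)) *
        (∑ y, zG k R (j, y) ⊗ₜ[k] zG k R (y, n)) =
        ∑ x, ∑ y, (zG k R (i, x) * zG k R (j, y)) ⊗ₜ[k] (zG k R (x, m) * zG k R (y, n)) := by
      intro m n
      simp only [Finset.sum_mul_sum, Algebra.TensorProduct.tmul_mul_tmul]
    have h2 : ∀ p s, (∑ x, zG k R (p, x) ⊗ₜ[k] zG k R (x, a)) *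
        (∑ y, zG k R (s, y) ⊗ₜ[k] zG k R (y, b)) =
        ∑ x, ∑ y, (zG k R (p, x) * zG k R (s, y)) ⊗ₜ[k] (zG k R (x, a) * zG k R (y, b)) := by
      intro m n
      simp only [Finset.sum_mul_sum, Algebra.TensorProduct.tmul_mul_tmul]
    simp only [h1, h2]
    have key1 : ∀ x y : Fin d,
        ∑ m, ∑ n, R (m, n) (a, b) • ((zG k R (i, x) * zG k R (j, y)) ⊗ₜ[k] (zG k R (x, m) * zG k R (y, n)))
        = ∑ p, ∑ s, R (x, y) (p, s) • ((zG k R (i, x) * zG k R (j, y)) ⊗ₜ[k] (zG k R (p, a) * zG k R (s, b))) := by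
      intro x y
      have := congrArg (fun w => (zG k R (i, x) * zG k R (j, y)) ⊗ₜ[k] w) (rtt R x y a b)
      simpa only [TensorProduct.tmul_sum, TensorProduct.tmul_smul] using this
    have key2 : ∀ p s : Fin d,
        ∑ x, ∑ y, R (x, y) (p, s) • ((zG k R (i, x) * zG k R (j, y)) ⊗ₜ[k] (zG k R (p, a) * zG k R (s, b)))
        = ∑ u, ∑ v, R (i, j) (u, v) • ((zG k R (u, p) * zG k R (v, s)) ⊗ₜ[k] (zG k R (p, a) * zG k R (s, b))) := by
      intro p s
      have := congrArg (fun w => w ⊗ₜ[k] (zG k R (p, a) * zG k R (s, b))) (rtt R i j p s)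
      simpa only [TensorProduct.sum_tmul, TensorProduct.smul_tmul'] using this
    have swap4 : ∀ g : Fin d → Fin d → Fin d → Fin d → MatrixQG k R ⊗[k] MatrixQG k R,
        ∑ m, ∑ n, ∑ x, ∑ y, g m n x y = ∑ x, ∑ y, ∑ m, ∑ n, g m n x y := by
      intro g
      simp only [← Fintype.sum_prod_type' (f := fun x y => g _ _ x y)]
      simp only [← Fintype.sum_prod_type']
      have := Finset.sum_comm (s := (Finset.univ : Finset (Fin d × Fin d)))
        (t := (Finset.univ : Finset (Fin d × Fin d))) (f := fun u v => g u.1 u.2 v.1 v.2)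
      simpa only [Fintype.sum_prod_type] using this
    simp only [Finset.smul_sum]
    rw [swap4]
    simp only [key1]
    rw [swap4]
    simp only [key2]
    rw [swap4]
  · intro i j
    have h : ∀ m, (∑ x, zG k R (i, x) ⊗ₜ[k] zG k R (x, m)) *
        (∑ y, tG k R (y, j) ⊗ₜ[k] tG k R (m, y)) =
        ∑ x, ∑ y, (zG k R (i, x) * tG k R (y, j)) ⊗ₜ[k] (zG k R (x, m) * tG k R (m, y)) := by
      intro m
      simp only [Finset.sum_mul_sum, Algebra.TensorProduct.tmul_mul_tmul]
    simp only [h]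
    rw [Finset.sum_comm]
    have h' : ∀ x, ∑ m, ∑ y, (zG k R (i, x) * tG k R (y, j)) ⊗ₜ[k] (zG k R (x, m) * tG k R (m, y))
        = (zG k R (i, x) * tG k R (x, j)) ⊗ₜ[k] 1 := by
      intro x
      rw [Finset.sum_comm]
      simp only [← TensorProduct.tmul_sum, zt]
      rw [Finset.sum_eq_single x]
      · simp
      · intro b _ hb
        simp [Ne.symm hb]
      · simp
    simp only [h', ← TensorProduct.sum_tmul, zt]
    rfl
  · intro i j
    have h : ∀ m, (∑ y, tG k R (y, m) ⊗ₜ[k] tG k R (i, y)) *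
        (∑ x, zG k R (m, x) ⊗ₜ[k] zG k R (x, j)) =
        ∑ y, ∑ x, (tG k R (y, m) * zG k R (m, x)) ⊗ₜ[k] (tG k R (i, y) * zG k R (x, j)) := by
      intro m
      simp only [Finset.sum_mul_sum, Algebra.TensorProduct.tmul_mul_tmul]
    simp only [h]
    rw [Finset.sum_comm]
    have h' : ∀ y, ∑ m, ∑ x, (tG k R (y, m) * zG k R (m, x)) ⊗ₜ[k] (tG k R (i, y) * zG k R (x, j))
        = 1 ⊗ₜ[k] (tG k R (i, y) * zG k R (y, j)) := by
      intro x
      rw [Finset.sum_comm]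
      simp only [← TensorProduct.sum_tmul, tz]
      rw [Finset.sum_eq_single x]
      · simp
      · intro b _ hb
        simp [Ne.symm hb]
      · simp
    simp only [h', ← TensorProduct.tmul_sum, tz]
    split_ifs <;> simp [Algebra.TensorProduct.one_def]

lemma exists_counit : ∃ F : MatrixQG k R →ₐ[k] k,
    (∀ i j, F (zG k R (i, j)) = if i = j then 1 else 0) ∧
    (∀ i j, F (tG k R (i, j)) = if i = j then 1 else 0) := by
  apply exists_lift
  · intro i j a b
    have e : ∀ (p q r s : Fin d), (if p = q then (1 : k) else 0) * (if r = s then 1 else 0) =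
      if p = q then (if r = s then 1 else 0) else 0 := by intros; split_ifs <;> simp
    simp [e]
  · intro i j; simp
  · intro i j; simp

variable (P : Matrix (Fin d × Fin d) (Fin d × Fin d) k) (C' : Matrix (Fin d) (Fin d) k)

lemma anti1 
    (h : (Matrix.of fun i j => zG k R (i, j))ᵀ * sc (MatrixQG k R) (Cm P)ᵀ *
      (Matrix.of fun i j => tG k R (i, j))ᵀ = sc (MatrixQG k R) (Cm P)ᵀ)
    (hC : Cm P * C' = 1) (i j : Fin d) :
    ∑ m, (∑ a, ∑ b, (Cm P m a * C' b j) • zG k R (a, b)) * tG k R (i, m) =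
      algebraMap k _ (if i = j then 1 else 0) := by
  have h1 : ∀ b, ∑ m, ∑ a, Cm P m a • (zG k R (a, b) * tG k R (i, m)) =
      algebraMap k _ (Cm P i b) := by
    intro b
    have := congrFun (congrFun h b) i
    simp only [Matrix.mul_apply, Matrix.transpose_apply, sc, Matrix.map_apply, Finset.sum_mul,
      Matrix.of_apply] at this
    rw [← this]
    refine Finset.sum_congr rfl fun x _ => Finset.sum_congr rfl fun y _ => ?_
    rw [Algebra.smul_def, ← mul_assoc, Algebra.commutes]
  have h2 : ∑ b, C' b j • algebraMap k (MatrixQG k R) (Cm P i b) =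
      algebraMap k _ (if i = j then 1 else 0) := by
    have := congrFun (congrFun hC i) j
    rw [Matrix.mul_apply, Matrix.one_apply] at this
    rw [← this, map_sum]
    refine Finset.sum_congr rfl fun x _ => ?_
    rw [Algebra.smul_def, ← map_mul, mul_comm]
  rw [← h2]
  simp only [← h1, Finset.smul_sum, Finset.sum_mul, smul_mul_assoc, smul_smul]
  rw [Finset.sum_comm (s := Finset.univ (α := Fin d)) (t := Finset.univ (α := Fin d)) (f := fun b m => ∑ a, (C' b j * Cm P m a) • (zG k R (a, b) * tG k R (i, m)))]
  refine Finset.sum_congr rfl fun x _ => ?_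
  rw [Finset.sum_comm]
  refine Finset.sum_congr rfl fun y _ => Finset.sum_congr rfl fun w _ => ?_
  rw [mul_comm]

lemma anti2
    (h : (Matrix.of fun i j => tG k R (i, j))ᵀ * sc (MatrixQG k R) C'ᵀ *
      (Matrix.of fun i j => zG k R (i, j))ᵀ = sc (MatrixQG k R) C'ᵀ)
    (hC : Cm P * C' = 1) (i j : Fin d) :
    ∑ m, tG k R (m, j) * (∑ a, ∑ b, (Cm P i a * C' b m) • zG k R (a, b)) =
      algebraMap k _ (if i = j then 1 else 0) := by
  have h1 : ∀ a, ∑ b, ∑ m, C' b m • (tG k R (m, j) * zG k R (a, b)) =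
      algebraMap k _ (C' a j) := by
    intro b
    have := congrFun (congrFun h j) b
    simp only [Matrix.mul_apply, Matrix.transpose_apply, sc, Matrix.map_apply, Finset.sum_mul,
      Matrix.of_apply] at this
    rw [← this]
    refine Finset.sum_congr rfl fun x _ => Finset.sum_congr rfl fun y _ => ?_
    rw [Algebra.smul_def, ← mul_assoc, Algebra.commutes]
  have h2 : ∑ a, Cm P i a • algebraMap k (MatrixQG k R) (C' a j) =
      algebraMap k _ (if i = j then 1 else 0) := by
    have := congrFun (congrFun hC i) j
    rw [Matrix.mul_apply, Matrix.one_apply] at this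
    rw [← this, map_sum]
    refine Finset.sum_congr rfl fun x _ => ?_
    rw [Algebra.smul_def, ← map_mul]
  rw [← h2]
  simp only [← h1, Finset.smul_sum, Finset.mul_sum, mul_smul_comm, smul_smul]
  rw [Finset.sum_comm]
  refine Finset.sum_congr rfl fun x _ => ?_
  rw [Finset.sum_comm]

/-- the matrix `Z` -/
noncomputable def zM : Matrix (Fin d) (Fin d) (MatrixQG k R) := Matrix.of fun i j => zG k R (i, j)
/-- the matrix `T` -/
noncomputable def tM : Matrix (Fin d) (Fin d) (MatrixQG k R) := Matrix.of fun i j => tG k R (i, j)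

lemma zM_tM : zM R * tM R = 1 := by
  ext i j
  rw [Matrix.mul_apply, Matrix.one_apply]
  refine (zt R i j).trans ?_
  split_ifs <;> simp

lemma tM_zM : tM R * zM R = 1 := by
  ext i j
  rw [Matrix.mul_apply, Matrix.one_apply]
  refine (tz R i j).trans ?_
  split_ifs <;> simp

lemma trel (i j a b : Fin d) : ∑ m, ∑ n, R (m, n) (a, b) • (tG k R (j, n) * tG k R (i, m)) =
      ∑ p, ∑ s, R (i, j) (p, s) • (tG k R (s, b) * tG k R (p, a)) := by
  let z := zM R
  let t := tM R
  have hzt : z * t = 1 := zM_tM R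
  have htz : t * z = 1 := tM_zM R
  have hz : ∀ x y : Fin d × Fin d, (leg1 z * leg2 z) x y = z x.1 y.1 * z x.2 y.2 := by
    intro x y
    simp [leg1, leg2, Matrix.mul_apply, Fintype.sum_prod_type]
  have ht : ∀ x y : Fin d × Fin d, (leg2 t * leg1 t) x y = t x.2 y.2 * t x.1 y.1 := by
    intro x y
    simp [leg1, leg2, Matrix.mul_apply, Fintype.sum_prod_type]
  have h1 : leg1 z * leg2 z * sc (MatrixQG k R) R = sc (MatrixQG k R) R * (leg1 z * leg2 z) := by
    ext ⟨i, j⟩ ⟨a, b⟩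
    have := rtt R i j a b
    simp only [Algebra.smul_def] at this
    rw [Matrix.mul_apply, Matrix.mul_apply]
    simp only [hz, sc, Matrix.map_apply, Fintype.sum_prod_type]
    refine Eq.trans ?_ this
    exact Finset.sum_congr rfl fun x _ => Finset.sum_congr rfl fun y _ => (Algebra.commutes _ _).symm
  have e1 : (leg1 z * leg2 z) * (leg2 t * leg1 t) = 1 := by
    rw [mul_assoc, ← mul_assoc (leg2 z), leg2_mul, hzt, leg2_one, one_mul, leg1_mul, hzt, leg1_one]
  have e2 : (leg2 t * leg1 t) * (leg1 z * leg2 z) = 1 := by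
    rw [mul_assoc, ← mul_assoc (leg1 t), leg1_mul, htz, leg1_one, one_mul, leg2_mul, htz, leg2_one]
  have h2 : (leg2 t * leg1 t) * sc (MatrixQG k R) R = sc (MatrixQG k R) R * (leg2 t * leg1 t) := by
    calc (leg2 t * leg1 t) * sc (MatrixQG k R) R
        = (leg2 t * leg1 t) * (sc (MatrixQG k R) R * (leg1 z * leg2 z)) * (leg2 t * leg1 t) := by
          rw [mul_assoc (leg2 t * leg1 t) (sc (MatrixQG k R) R * _), mul_assoc (sc (MatrixQG k R) R), e1, mul_one]
      _ = ((leg2 t * leg1 t) * (leg1 z * leg2 z)) * sc (MatrixQG k R) R * (leg2 t * leg1 t) := by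
          rw [← h1]; simp only [mul_assoc]
      _ = _ := by rw [e2, one_mul]
  have := congrFun (congrFun h2 (i, j)) (a, b)
  rw [Matrix.mul_apply, Matrix.mul_apply] at this
  simp only [ht, sc, Matrix.map_apply, Fintype.sum_prod_type] at this
  simp only [Algebra.smul_def]
  refine Eq.trans ?_ this
  exact Finset.sum_congr rfl fun x _ => Finset.sum_congr rfl fun y _ => Algebra.commutes _ _

lemma exists_antipode
    (h1 : ∀ i j, ∑ m, (∑ a, ∑ b, (Cm P m a * C' b j) • zG k R (a, b)) * tG k R (i, m) =
      algebraMap k _ (if i = j then 1 else 0))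
    (h2 : ∀ i j, ∑ m, tG k R (m, j) * (∑ a, ∑ b, (Cm P i a * C' b m) • zG k R (a, b)) =
      algebraMap k _ (if i = j then 1 else 0)) :
    ∃ F : MatrixQG k R →ₐ[k] (MatrixQG k R)ᵐᵒᵖ,
    (∀ i j, F (zG k R (i, j)) = MulOpposite.op (tG k R (i, j))) ∧
    (∀ i j, F (tG k R (i, j)) = MulOpposite.op (∑ a, ∑ b, (Cm P i a * C' b j) • zG k R (a, b))) := by
  apply exists_lift
  · intro i j a b
    simp only [← MulOpposite.op_mul, ← MulOpposite.op_smul, ← Finset.op_sum, trel]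
  · intro i j
    simp only [← MulOpposite.op_mul, ← Finset.op_sum, h1]
    rfl
  · intro i j
    simp only [← MulOpposite.op_mul, ← Finset.op_sum, h2]
    rfl

end alg
end MQG

/-- In the Hopf algebra `H` of a closed Hecke symmetry `R` (with `P` the inverse of the
half dual `R^♯` and `C^i_j = P^{im}_{jm}` invertible with inverse `C'`), the matrix `T` is a
two-sided inverse of `Z`, and there exist `Δ`, `ε` and an antipode `S` with
`S(z^i_j) = t^i_j`, `S(t^i_j) = Σ C^i_k z^k_l (C⁻¹)^l_j`, satisfying the coassociativity,
counit and antipode axioms: `H` is a Hopf algebra. -/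
theorem matrixQG_hopf {k : Type*} [Field k] {d : ℕ} (q : k) (hq0 : q ≠ 0) (hq1 : q ≠ -1)
    (R : Matrix (Fin d × Fin d) (Fin d × Fin d) k)
    (hinv : IsUnit R)
    (hHecke : (R + 1) * (R - q • 1) = 0)
    (P : Matrix (Fin d × Fin d) (Fin d × Fin d) k)
    (hP : ∀ i j a b : Fin d,
      ∑ m : Fin d, ∑ n : Fin d, P (i, m) (j, n) * R (n, a) (m, b) =
        (if i = b then 1 else 0) * (if a = j then 1 else 0))
    (C' : Matrix (Fin d) (Fin d) k)
    (hC : (Matrix.of fun i j : Fin d => ∑ m : Fin d, P (i, m) (j, m)) * C' = 1)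
    (hC' : C' * (Matrix.of fun i j : Fin d => ∑ m : Fin d, P (i, m) (j, m)) = 1) :
    (∀ i j : Fin d, ∑ m : Fin d, zG k R (i, m) * tG k R (m, j) =
      algebraMap k (MatrixQG k R) (if i = j then 1 else 0)) ∧
    (∀ i j : Fin d, ∑ m : Fin d, tG k R (i, m) * zG k R (m, j) =
      algebraMap k (MatrixQG k R) (if i = j then 1 else 0)) ∧
    ∃ (Δ : MatrixQG k R →ₐ[k] MatrixQG k R ⊗[k] MatrixQG k R)
      (ε : MatrixQG k R →ₐ[k] k) (S : MatrixQG k R →ₗ[k] MatrixQG k R),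
      (∀ i j : Fin d, Δ (zG k R (i, j)) = ∑ m : Fin d, zG k R (i, m) ⊗ₜ[k] zG k R (m, j)) ∧
      (∀ i j : Fin d, Δ (tG k R (i, j)) = ∑ m : Fin d, tG k R (m, j) ⊗ₜ[k] tG k R (i, m)) ∧
      (∀ i j : Fin d, ε (zG k R (i, j)) = if i = j then 1 else 0) ∧
      (∀ i j : Fin d, ε (tG k R (i, j)) = if i = j then 1 else 0) ∧
      (∀ i j : Fin d, S (zG k R (i, j)) = tG k R (i, j)) ∧
      (∀ i j : Fin d, S (tG k R (i, j)) =
        ∑ a : Fin d, ∑ b : Fin d,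
          ((∑ m : Fin d, P (i, m) (a, m)) * C' b j) • zG k R (a, b)) ∧
      (∀ x : MatrixQG k R,
        (TensorProduct.assoc k (MatrixQG k R) (MatrixQG k R) (MatrixQG k R))
            ((Δ.toLinearMap.rTensor (MatrixQG k R)) (Δ x)) =
          (LinearMap.lTensor (MatrixQG k R) Δ.toLinearMap) (Δ x)) ∧
      (∀ x : MatrixQG k R,
        (TensorProduct.rid k (MatrixQG k R))
          ((LinearMap.lTensor (MatrixQG k R) ε.toLinearMap) (Δ x)) = x) ∧
      (∀ x : MatrixQG k R,
        (TensorProduct.lid k (MatrixQG k R))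
          ((ε.toLinearMap.rTensor (MatrixQG k R)) (Δ x)) = x) ∧
      (∀ x : MatrixQG k R,
        (LinearMap.mul' k (MatrixQG k R)) ((S.rTensor (MatrixQG k R)) (Δ x)) =
          algebraMap k (MatrixQG k R) (ε x)) ∧
      (∀ x : MatrixQG k R,
        (LinearMap.mul' k (MatrixQG k R)) ((S.lTensor (MatrixQG k R)) (Δ x)) =
          algebraMap k (MatrixQG k R) (ε x)) := by
  classical
  have hPR := MQG.PsRs R P hP
  have hzt := MQG.zM_tM R
  have htz := MQG.tM_zM R
  have hm := MQG.mid R (MQG.zM R) (MQG.tM R) hzt htz (MQG.rtt R)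
  have hk := MQG.key R P (MQG.zM R) (MQG.tM R) hPR hm
  have hCr := MQG.relC P (MQG.zM R) (MQG.tM R) htz hk
  have hCr' := MQG.relC' R P (MQG.zM R) (MQG.tM R) hzt htz hPR hk C' hC'
  have a1 := MQG.anti1 R P C' hCr hC
  have a2 := MQG.anti2 R P C' hCr' hC
  obtain ⟨Δ, Δz, Δt⟩ := MQG.exists_comul R
  obtain ⟨ε, εz, εt⟩ := MQG.exists_counit R
  obtain ⟨S0, Sz0, St0⟩ := MQG.exists_antipode R P C' a1 a2
  let S : MatrixQG k R →ₗ[k] MatrixQG k R :=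
    (MulOpposite.opLinearEquiv k).symm.toLinearMap ∘ₗ S0.toLinearMap
  have Sz : ∀ i j, S (zG k R (i, j)) = tG k R (i, j) := fun i j => by simp [S, Sz0]
  have St : ∀ i j, S (tG k R (i, j)) =
      ∑ a, ∑ b, (MQG.Cm P i a * C' b j) • zG k R (a, b) := fun i j => by
    simp only [S, LinearMap.comp_apply, AlgHom.toLinearMap_apply, St0]
    rfl
  have Smul : ∀ x y, S (x * y) = S y * S x := fun x y => by simp [S]
  have Salg : ∀ r : k, S (algebraMap k _ r) = algebraMap k _ r := fun r => by
    simp only [S, LinearMap.comp_apply, AlgHom.toLinearMap_apply, AlgHom.commutes]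
    rfl
  refine ⟨MQG.zt R, MQG.tz R, Δ, ε, S, Δz, Δt, εz, εt, Sz, St, ?_, ?_, ?_, ?_, ?_⟩
  · have h : ((Algebra.TensorProduct.assoc k k k (MatrixQG k R) (MatrixQG k R)
        (MatrixQG k R)).toAlgHom.comp
        (Algebra.TensorProduct.map Δ (AlgHom.id k (MatrixQG k R)))).comp Δ =
        (Algebra.TensorProduct.map (AlgHom.id k (MatrixQG k R)) Δ).comp Δ := by
      apply MQG.qext
      · intro i j
        simp [Δz, TensorProduct.sum_tmul, TensorProduct.tmul_sum]
        rw [Finset.sum_comm]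
      · intro i j
        simp [Δt, TensorProduct.sum_tmul, TensorProduct.tmul_sum]
        rw [Finset.sum_comm]
    intro x
    exact congrArg (fun F => F x) h
  · have h : ((Algebra.TensorProduct.rid k k (MatrixQG k R)).toAlgHom.comp
        (Algebra.TensorProduct.map (AlgHom.id k (MatrixQG k R)) ε)).comp Δ =
        AlgHom.id k (MatrixQG k R) := by
      apply MQG.qext
      · intro i j
        simp [Δz, εz]
      · intro i j
        simp [Δt, εt]
    intro x
    exact congrArg (fun F => F x) h
  · have h : ((Algebra.TensorProduct.lid k (MatrixQG k R)).toAlgHom.comp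
        (Algebra.TensorProduct.map ε (AlgHom.id k (MatrixQG k R)))).comp Δ =
        AlgHom.id k (MatrixQG k R) := by
      apply MQG.qext
      · intro i j
        simp [Δz, εz]
      · intro i j
        simp [Δt, εt]
    intro x
    exact congrArg (fun F => F x) h
  · apply MQG.qind
    · intro i j
      simp only [Δz, map_sum, LinearMap.rTensor_tmul, LinearMap.mul'_apply, Sz, εz, MQG.tz]
    · intro i j
      simp only [Δt, map_sum, LinearMap.rTensor_tmul, LinearMap.mul'_apply, St, εt, a1]
    · intro r
      simp only [AlgHom.commutes, Algebra.TensorProduct.algebraMap_apply,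
        LinearMap.rTensor_tmul, LinearMap.mul'_apply, Salg, mul_one]
      rfl
    · intro x y hx hy
      simp only [map_add, hx, hy]
    · intro x y hx hy
      have key : ∀ u v : MatrixQG k R ⊗[k] MatrixQG k R, ∀ r : k,
          LinearMap.mul' k (MatrixQG k R) (S.rTensor (MatrixQG k R) u) = algebraMap k _ r →
          LinearMap.mul' k (MatrixQG k R) (S.rTensor (MatrixQG k R) (u * v)) =
            algebraMap k _ r * LinearMap.mul' k (MatrixQG k R) (S.rTensor (MatrixQG k R) v) := by
        intro u v r hu
        induction v with
        | zero => simp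
        | add a b ha hb => rw [mul_add, map_add, map_add, ha, hb, map_add, map_add, mul_add]
        | tmul a b =>
          have : LinearMap.mul' k (MatrixQG k R) (S.rTensor (MatrixQG k R) (u * a ⊗ₜ[k] b)) =
              S a * LinearMap.mul' k (MatrixQG k R) (S.rTensor (MatrixQG k R) u) * b := by
            clear hu
            induction u with
            | zero => simp
            | add c e hc he => rw [add_mul, map_add, map_add, hc, he, map_add, map_add, mul_add, add_mul]
            | tmul c e =>
              simp only [Algebra.TensorProduct.tmul_mul_tmul, LinearMap.rTensor_tmul,
                LinearMap.mul'_apply, Smul, mul_assoc]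
          rw [this, hu, ← Algebra.commutes, mul_assoc]
          simp only [LinearMap.rTensor_tmul, LinearMap.mul'_apply]
      rw [map_mul, key _ _ _ hx, hy, map_mul, map_mul]
  · apply MQG.qind
    · intro i j
      simp only [Δz, map_sum, LinearMap.lTensor_tmul, LinearMap.mul'_apply, Sz, εz, MQG.zt]
    · intro i j
      simp only [Δt, map_sum, LinearMap.lTensor_tmul, LinearMap.mul'_apply, St, εt, a2]
    · intro r
      have h1 : S 1 = 1 := by simpa using Salg 1
      simp only [AlgHom.commutes, Algebra.TensorProduct.algebraMap_apply,
        LinearMap.lTensor_tmul, LinearMap.mul'_apply, h1, mul_one]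
      rfl
    · intro x y hx hy
      simp only [map_add, hx, hy]
    · intro x y hx hy
      have key : ∀ u v : MatrixQG k R ⊗[k] MatrixQG k R, ∀ r : k,
          LinearMap.mul' k (MatrixQG k R) (S.lTensor (MatrixQG k R) v) = algebraMap k _ r →
          LinearMap.mul' k (MatrixQG k R) (S.lTensor (MatrixQG k R) (u * v)) =
            LinearMap.mul' k (MatrixQG k R) (S.lTensor (MatrixQG k R) u) * algebraMap k _ r := by
        intro u v r hv
        induction u with
        | zero => simp
        | add a b ha hb => rw [add_mul, map_add, map_add, ha, hb, map_add, map_add, add_mul]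
        | tmul a b =>
          have : LinearMap.mul' k (MatrixQG k R) (S.lTensor (MatrixQG k R) (a ⊗ₜ[k] b * v)) =
              a * LinearMap.mul' k (MatrixQG k R) (S.lTensor (MatrixQG k R) v) * S b := by
            clear hv
            induction v with
            | zero => simp
            | add c e hc he => rw [mul_add, map_add, map_add, hc, he, map_add, map_add, mul_add, add_mul]
            | tmul c e =>
              simp only [Algebra.TensorProduct.tmul_mul_tmul, LinearMap.lTensor_tmul,
                LinearMap.mul'_apply, Smul, mul_assoc]
          rw [this, hv, mul_assoc, Algebra.commutes, ← mul_assoc]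
          simp only [LinearMap.lTensor_tmul, LinearMap.mul'_apply]
      rw [map_mul, key _ _ _ hy, hx, map_mul, map_mul]
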